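/- Let M be an n×n Hermitian matrix, 1 ≤ k ≤ n, A a uniformly random k×k principal submatrix of M, and F(x) = E[F_A(x)]. Then E||F_A − F||_∞ ≤ (13 + √8·log k)/√k. -/

import Mathlib

open scoped Classical
open Matrix Finset

/-- Empirical spectral distribution function of a Hermitian matrix. -/
noncomputable def esd {m : Type*} [Fintype m] [DecidableEq m] {A : Matrix m m ℂ}
    (hA : A.IsHermitian) (x : ℝ) : ℝ :=
  ((Finset.univ.filter fun i => hA.eigenvalues i ≤ x).card : ℝ) / Fintype.card m

/-- ESD at `x` of the principal submatrix of `M` indexed by `p 1, …, p k`. -/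
noncomputable def fESD {n k : ℕ} (hk : k ≤ n) (M : Matrix (Fin n) (Fin n) ℂ)
    (hM : M.IsHermitian) (p : Equiv.Perm (Fin n)) (x : ℝ) : ℝ :=
  esd (hM.submatrix (fun a : Fin k => p (Fin.castLE hk a))) x

/-- `F(x) = E[F_A(x)]` for a uniformly random `k × k` principal submatrix. -/
noncomputable def meanESD {n k : ℕ} (hk : k ≤ n) (M : Matrix (Fin n) (Fin n) ℂ)
    (hM : M.IsHermitian) (x : ℝ) : ℝ :=
  (∑ p : Equiv.Perm (Fin n), fESD hk M hM p x) / Fintype.card (Equiv.Perm (Fin n))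

/-- The quadratic form of a Hermitian matrix in the coordinates of its eigenvector basis. -/
theorem Matrix.IsHermitian.re_inner_toEuclideanLin {ι : Type*} [Fintype ι] [DecidableEq ι]
    {A : Matrix ι ι ℂ} (hA : A.IsHermitian) (v : EuclideanSpace ℂ ι) :
    (inner ℂ v (toEuclideanLin A v)).re =
      ∑ i, hA.eigenvalues i * ‖inner ℂ (hA.eigenvectorBasis i) v‖ ^ 2 := by
  rw [← hA.eigenvectorBasis.sum_inner_mul_inner, Complex.re_sum]
  refine Finset.sum_congr rfl fun i _ => ?_
  have heig : toEuclideanLin A (hA.eigenvectorBasis i) =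
      (hA.eigenvalues i : ℂ) • hA.eigenvectorBasis i := by
    ext j
    simpa using congrFun (hA.mulVec_eigenvectorBasis i) j
  rw [← isSymmetric_toEuclideanLin_iff.2 hA, heig, inner_smul_left, Complex.conj_ofReal,
    mul_left_comm, Complex.re_ofReal_mul, ← inner_conj_symm v, Complex.conj_mul']
  norm_cast

/-- Two Hermitian matrices that agree off the rows and columns in `S` have eigenvalue counting
functions that differ by at most `#S`. -/
theorem card_eigenvalues_le_add_card {ι : Type*} [Fintype ι] [DecidableEq ι]
    {A B : Matrix ι ι ℂ} (hA : A.IsHermitian) (hB : B.IsHermitian) (S : Finset ι)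
    (h : ∀ i ∉ S, ∀ j ∉ S, A i j = B i j) (x : ℝ) :
    (univ.filter fun i => hA.eigenvalues i ≤ x).card ≤
      (univ.filter fun i => hB.eigenvalues i ≤ x).card + S.card := by
  by_contra! hlt
  let L : EuclideanSpace ℂ ι →ₗ[ℂ] ({i // ¬ hA.eigenvalues i ≤ x} → ℂ) ×
      ({i // hB.eigenvalues i ≤ x} → ℂ) × (S → ℂ) :=
    (LinearMap.pi fun i : {i // ¬ hA.eigenvalues i ≤ x} =>
      (innerSL ℂ (hA.eigenvectorBasis i)).toLinearMap).prod
      ((LinearMap.pi fun i : {i // hB.eigenvalues i ≤ x} =>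
        (innerSL ℂ (hB.eigenvectorBasis i)).toLinearMap).prod
        (LinearMap.pi fun i : S => (EuclideanSpace.proj (𝕜 := ℂ) i.1).toLinearMap))
  have hdim : Module.finrank ℂ (({i // ¬ hA.eigenvalues i ≤ x} → ℂ) ×
      ({i // hB.eigenvalues i ≤ x} → ℂ) × (S → ℂ)) <
      Module.finrank ℂ (EuclideanSpace ℂ ι) := by
    have hsum := Finset.card_filter_add_card_filter_not (s := (univ : Finset ι))
      fun i => hA.eigenvalues i ≤ x
    simp only [Module.finrank_prod, Module.finrank_fintype_fun_eq_card, finrank_euclideanSpace,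
      Fintype.card_subtype]
    rw [Finset.card_univ] at hsum
    rw [Finset.filter_univ_mem]
    omega
  obtain ⟨v, hv, hv0⟩ := Submodule.exists_mem_ne_zero_of_ne_bot
    (LinearMap.ker_ne_bot_of_finrank_lt (f := L) hdim)
  simp only [L, LinearMap.mem_ker, LinearMap.prod_apply, Function.prod, Prod.mk_eq_zero,
    funext_iff, LinearMap.pi_apply, Pi.zero_apply, Subtype.forall, ContinuousLinearMap.coe_coe,
    innerSL_apply_apply, PiLp.proj_apply] at hv
  obtain ⟨hvA, hvB, hvS⟩ := hv
  have hforms : inner ℂ v (toEuclideanLin A v) = inner ℂ v (toEuclideanLin B v) := by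
    simp only [PiLp.inner_apply, ofLp_toLpLin, toLin'_apply, mulVec, dotProduct]
    refine Finset.sum_congr rfl fun i _ => ?_
    by_cases hi : i ∈ S
    · simp [hvS i hi]
    · congr 1
      refine Finset.sum_congr rfl fun j _ => ?_
      by_cases hj : j ∈ S
      · simp [hvS j hj]
      · rw [h i hi j hj]
  have hAle : (inner ℂ v (toEuclideanLin A v)).re ≤ x * ‖v‖ ^ 2 := by
    rw [hA.re_inner_toEuclideanLin, ← hA.eigenvectorBasis.sum_sq_norm_inner_right v,
      Finset.mul_sum]
    refine Finset.sum_le_sum fun i _ => ?_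
    by_cases hi : hA.eigenvalues i ≤ x
    · gcongr
    · simp [hvA i hi]
  have hBlt : x * ‖v‖ ^ 2 < (inner ℂ v (toEuclideanLin B v)).re := by
    have hle : ∀ i, x * ‖inner ℂ (hB.eigenvectorBasis i) v‖ ^ 2 ≤
        hB.eigenvalues i * ‖inner ℂ (hB.eigenvectorBasis i) v‖ ^ 2 := fun i => by
      by_cases hi : hB.eigenvalues i ≤ x
      · simp [hvB i hi]
      · gcongr
        exact (not_le.1 hi).le
    obtain ⟨i, hi⟩ : ∃ i, inner ℂ (hB.eigenvectorBasis i) v ≠ 0 := by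
      by_contra! hzero
      have := hB.eigenvectorBasis.sum_sq_norm_inner_right v
      exact hv0 (by simpa [hzero] using this.symm)
    rw [hB.re_inner_toEuclideanLin, ← hB.eigenvectorBasis.sum_sq_norm_inner_right v,
      Finset.mul_sum]
    refine Finset.sum_lt_sum (fun i _ => hle i) ⟨i, Finset.mem_univ i, ?_⟩
    gcongr
    exact not_le.1 fun hix => hi (hvB i hix)
  rw [hforms] at hAle
  exact absurd hBlt (not_lt.2 hAle)

/-- An exponential moment bound for a function of small oscillation on a finite type. -/
theorem sum_exp_sub_mean_le {ι : Type*} [Fintype ι] {h : ι → ℝ} {μ d : ℝ} (hd : d ≤ 1)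
    (hμ : ∑ a, h a = Fintype.card ι * μ) (hosc : ∀ a b, |h a - h b| ≤ d) :
    ∑ a, Real.exp (h a - μ) ≤ Fintype.card ι * Real.exp (d ^ 2) := by
  have hdev : ∀ a, |h a - μ| ≤ d := fun a => by
    have hpos : (0 : ℝ) < Fintype.card ι := Nat.cast_pos.2 (Fintype.card_pos_iff.2 ⟨a⟩)
    refine le_of_mul_le_mul_left ?_ hpos
    calc (Fintype.card ι : ℝ) * |h a - μ| = |∑ b, (h a - h b)| := by
          rw [Finset.sum_sub_distrib, hμ, Finset.sum_const, Finset.card_univ, nsmul_eq_mul,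
            ← mul_sub, abs_mul, abs_of_pos hpos]
      _ ≤ ∑ b, |h a - h b| := Finset.abs_sum_le_sum_abs _ _
      _ ≤ ∑ _b : ι, d := Finset.sum_le_sum fun b _ => hosc a b
      _ = Fintype.card ι * d := by simp
  calc ∑ a, Real.exp (h a - μ) ≤ ∑ a, (1 + d ^ 2 + (h a - μ)) := by
        refine Finset.sum_le_sum fun a _ => ?_
        have h1 := (abs_le.1 (Real.abs_exp_sub_one_sub_id_le ((hdev a).trans hd))).2
        have h2 : (h a - μ) ^ 2 ≤ d ^ 2 := sq_le_sq.2 ((hdev a).trans (le_abs_self d))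
        linarith
    _ = Fintype.card ι * (d ^ 2 + 1) := by
        rw [Finset.sum_add_distrib, Finset.sum_sub_distrib, hμ]
        simp
        ring
    _ ≤ Fintype.card ι * Real.exp (d ^ 2) := by
        gcongr
        exact Real.add_one_le_exp _

theorem Equiv.Perm.decomposeFin_symm_eq_swap_mul {n : ℕ} (a : Fin (n + 1))
    (q : Equiv.Perm (Fin n)) :
    decomposeFin.symm (a, q) = swap 0 a * decomposeFin.symm (0, q) := by
  ext i
  refine Fin.cases ?_ (fun j => ?_) i <;> simp

theorem Equiv.Perm.decomposeFin_symm_swap_mul {n : ℕ} (a : Fin (n + 1)) (x y : Fin n)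
    (q : Equiv.Perm (Fin n)) :
    decomposeFin.symm (a, swap x y * q) =
      swap (swap 0 a x.succ) (swap 0 a y.succ) * decomposeFin.symm (a, q) := by
  have hzero : decomposeFin.symm (0, swap x y * q) =
      swap x.succ y.succ * decomposeFin.symm (0, q) := by
    ext i
    refine Fin.cases ?_ (fun j => ?_) i
    · simp [swap_apply_of_ne_of_ne (Fin.succ_ne_zero x).symm (Fin.succ_ne_zero y).symm]
    · simp [(Fin.succ_injective n).swap_apply]
  rw [decomposeFin_symm_eq_swap_mul, hzero, decomposeFin_symm_eq_swap_mul a q, ← mul_assoc,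
    ← mul_assoc, mul_swap_eq_swap_mul]

/-- An exponential moment bound for a function of the first `k` values of a uniformly random
permutation that changes by at most `δ` under composition with a transposition. -/
theorem Equiv.Perm.sum_exp_sub_mean_le {k n : ℕ} {f : Equiv.Perm (Fin n) → ℝ} {μ δ : ℝ}
    (hδ : 2 * δ ≤ 1) (hμ : ∑ p, f p = Fintype.card (Equiv.Perm (Fin n)) * μ)
    (hswap : ∀ x y p, |f (swap x y * p) - f p| ≤ δ)
    (hdep : ∀ p q : Equiv.Perm (Fin n), (∀ i : Fin n, (i : ℕ) < k → p i = q i) → f p = f q) :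
    ∑ p, Real.exp (f p - μ) ≤
      Fintype.card (Equiv.Perm (Fin n)) * Real.exp (k * (2 * δ) ^ 2) := by
  induction k generalizing n μ with
  | zero =>
    have hconst : ∀ p, f p = f 1 := fun p => hdep p 1 fun i hi => absurd hi (Nat.not_lt_zero _)
    have hcard : (Fintype.card (Equiv.Perm (Fin n)) : ℝ) ≠ 0 := by
      exact_mod_cast Fintype.card_ne_zero
    have hμ' : f 1 = μ := by simpa [hconst, hcard] using hμ
    simp [hconst, hμ']
  | succ k ih =>
    cases n with
    | zero =>
      refine (ih hμ hswap fun p q _ => hdep p q fun i => i.elim0).trans ?_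
      gcongr
      simp
    | succ n =>
      set N : ℝ := (Fintype.card (Equiv.Perm (Fin n)) : ℝ) with hN
      have hN0 : 0 < N := by
        rw [hN]
        exact_mod_cast Fintype.card_pos
      have hcard : (Fintype.card (Equiv.Perm (Fin (n + 1))) : ℝ) = (n + 1) * N := by
        simp [hN, Fintype.card_perm, Nat.factorial_succ]
      have hsum (F : Equiv.Perm (Fin (n + 1)) → ℝ) :
          ∑ p, F p = ∑ a, ∑ q, F (decomposeFin.symm (a, q)) := by
        rw [← Fintype.sum_prod_type', ← decomposeFin.symm.sum_comp]
      let h (a : Fin (n + 1)) : ℝ := (∑ q, f (decomposeFin.symm (a, q))) / N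
      have hh (a) : ∑ q, f (decomposeFin.symm (a, q)) = N * h a := by
        simp only [h]
        field_simp
      have hzero (a) : |h a - h 0| ≤ δ := by
        simp only [h]
        rw [← sub_div, ← Finset.sum_sub_distrib, abs_div, abs_of_pos hN0, div_le_iff₀ hN0]
        refine (Finset.abs_sum_le_sum_abs _ _).trans ?_
        refine (Finset.sum_le_sum (g := fun _ => δ) fun q _ => ?_).trans ?_
        · rw [decomposeFin_symm_eq_swap_mul]
          exact hswap _ _ _
        · simp [hN, mul_comm]
      have hosc (a b) : |h a - h b| ≤ 2 * δ := by
        have ha := hzero a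
        have hb := hzero b
        rw [abs_le] at *
        constructor <;> linarith
      have hmean : ∑ a, h a = Fintype.card (Fin (n + 1)) * μ := by
        rw [hsum, hcard] at hμ
        simp only [hh, ← Finset.mul_sum] at hμ
        rw [Fintype.card_fin]
        push_cast
        refine mul_left_cancel₀ hN0.ne' ?_
        linarith
      have hinner (a) : ∑ q, Real.exp (f (decomposeFin.symm (a, q)) - h a) ≤
          N * Real.exp (k * (2 * δ) ^ 2) := by
        refine ih (f := fun q => f (decomposeFin.symm (a, q))) (hh a) (fun x y q => ?_)
          fun p q hpq => hdep _ _ fun i => ?_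
        · rw [decomposeFin_symm_swap_mul]
          exact hswap _ _ _
        · refine Fin.cases (fun _ => by simp) (fun j hj => ?_) i
          rw [decomposeFin_symm_apply_succ, decomposeFin_symm_apply_succ,
            hpq j (by simpa using hj)]
      rw [hsum]
      calc ∑ a, ∑ q, Real.exp (f (decomposeFin.symm (a, q)) - μ)
          = ∑ a, Real.exp (h a - μ) *
              ∑ q, Real.exp (f (decomposeFin.symm (a, q)) - h a) := by
            simp_rw [Finset.mul_sum, ← Real.exp_add]
            simp
        _ ≤ ∑ a, Real.exp (h a - μ) * (N * Real.exp (k * (2 * δ) ^ 2)) := by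
            gcongr with a
            exact hinner a
        _ ≤ Fintype.card (Fin (n + 1)) * Real.exp ((2 * δ) ^ 2) *
              (N * Real.exp (k * (2 * δ) ^ 2)) := by
            rw [← Finset.sum_mul]
            gcongr
            exact _root_.sum_exp_sub_mean_le hδ hmean hosc
        _ = _ := by
            rw [hcard, Fintype.card_fin]
            push_cast
            rw [add_mul (k : ℝ), one_mul, Real.exp_add]
            ring

/-- Finitely many points at which to compare a random bounded counting function with its mean: every
`x` lies between two of them at which the total count is off by at most `Fintype.card Ω`. -/
theorem exists_quantile_grid {Ω : Type*} [Fintype Ω] [Nonempty Ω] {k : ℕ} {c : Ω → ℝ → ℕ}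
    (hmono : ∀ ω, Monotone (c ω)) (hck : ∀ ω x, c ω x ≤ k) :
    ∃ l u : ℕ → ℝ, ∀ x, ∃ j ≤ k, (∀ ω, c ω (l j) ≤ c ω x ∧ c ω x ≤ c ω (u j)) ∧
      ∑ ω, c ω (u j) ≤ ∑ ω, c ω x + Fintype.card Ω ∧
      ∑ ω, c ω x ≤ ∑ ω, c ω (l j) + Fintype.card Ω := by
  set G : ℝ → ℕ := fun x => ∑ ω, c ω x with hG
  have hcard : 0 < Fintype.card Ω := Fintype.card_pos
  have hGle (x) : G x ≤ k * Fintype.card Ω := by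
    simpa [mul_comm] using Finset.sum_le_sum fun ω (_ : ω ∈ univ) => hck ω x
  have hcomp {x y} (h : G x ≤ G y) (ω) : c ω x ≤ c ω y := by
    rcases le_total x y with hxy | hyx
    · exact hmono ω hxy
    · have hle : ∀ ω ∈ univ, c ω y ≤ c ω x := fun ω _ => hmono ω hyx
      exact ((Finset.sum_eq_sum_iff_of_le hle).1 ((Finset.sum_le_sum hle).antisymm h)
        ω (mem_univ ω)).ge
  have hcell (j : ℕ) : ∃ l u, ∀ x, G x / Fintype.card Ω = j →
      (∀ ω, c ω l ≤ c ω x ∧ c ω x ≤ c ω u) ∧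
      G u ≤ G x + Fintype.card Ω ∧ G x ≤ G l + Fintype.card Ω := by
    let T : Set ℕ := G '' {x | G x / Fintype.card Ω = j}
    by_cases hT : T.Nonempty
    · have hbdd : BddAbove T := ⟨k * Fintype.card Ω, by
        rintro _ ⟨x, -, rfl⟩
        exact hGle x⟩
      obtain ⟨l, hl, hlmin⟩ := Nat.sInf_mem hT
      obtain ⟨u, hu, humax⟩ := Nat.sSup_mem hT hbdd
      refine ⟨l, u, fun x hx => ?_⟩
      have hlx : G l ≤ G x := hlmin ▸ Nat.sInf_le ⟨x, hx, rfl⟩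
      have hxu : G x ≤ G u := humax ▸ le_csSup hbdd ⟨x, hx, rfl⟩
      refine ⟨fun ω => ⟨hcomp hlx ω, hcomp hxu ω⟩, ?_⟩
      have hcell_bounds {y} (hy : G y / Fintype.card Ω = j) :=
        (Nat.div_eq_iff hcard).1 hy
      have hl' := hcell_bounds hl
      have hx' := hcell_bounds hx
      have hu' := hcell_bounds hu
      omega
    · exact ⟨0, 0, fun x hx => absurd ⟨G x, x, hx, rfl⟩ hT⟩
  choose l u hlu using hcell
  refine ⟨l, u, fun x => ⟨G x / Fintype.card Ω, ?_, hlu _ x rfl⟩⟩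
  exact (Nat.div_le_div_right (hGle x)).trans (Nat.mul_div_cancel k hcard).le

/-- Pointwise exponential moment bounds for a random distribution function with values in
`{0, 1/k, …, 1}` give a bound on its mean sup-norm deviation. -/
theorem mean_iSup_abs_sub_le {Ω : Type*} [Fintype Ω] [Nonempty Ω] {k : ℕ} (hk : 0 < k)
    {c : Ω → ℝ → ℕ} (hmono : ∀ ω, Monotone (c ω)) (hck : ∀ ω x, c ω x ≤ k)
    {F : ℝ → ℝ} (hF : ∀ x, F x = (∑ ω, (c ω x : ℝ) / k) / Fintype.card Ω)
    {s C : ℝ} (hs : 0 < s) (hC : 0 < C)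
    (hpos : ∀ x, ∑ ω, Real.exp (s * ((c ω x : ℝ) / k - F x)) ≤ Fintype.card Ω * C)
    (hneg : ∀ x, ∑ ω, Real.exp (-s * ((c ω x : ℝ) / k - F x)) ≤ Fintype.card Ω * C) :
    (∑ ω, ⨆ x : ℝ, |(c ω x : ℝ) / k - F x|) / Fintype.card Ω ≤
      1 / k + Real.log (2 * (k + 1) * C) / s := by
  obtain ⟨l, u, hlu⟩ := exists_quantile_grid hmono hck
  have hk' : (0 : ℝ) < k := Nat.cast_pos.2 hk
  set N : ℝ := (Fintype.card Ω : ℝ) with hN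
  have hN0 : 0 < N := Nat.cast_pos.2 Fintype.card_pos
  have hF' (x) : F x = (∑ ω, c ω x : ℕ) / (k * N) := by
    rw [hF, ← Finset.sum_div, div_div, Nat.cast_sum]
  have hFstep {x y} (h : ∑ ω, c ω x ≤ ∑ ω, c ω y + Fintype.card Ω) : F x ≤ F y + 1 / k := by
    rw [hF', hF', show (1 : ℝ) / k = N / (k * N) by field_simp, ← add_div]
    gcongr
    rw [hN]
    exact_mod_cast h
  let Z (ω : Ω) : ℝ := ∑ j ∈ range (k + 1), (Real.exp (s * ((c ω (u j) : ℝ) / k - F (u j))) +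
    Real.exp (-s * ((c ω (l j) : ℝ) / k - F (l j))))
  have hZpos (ω) : 0 < Z ω := Finset.sum_pos (fun j _ => by positivity) ⟨0, by simp⟩
  have hZsum : ∑ ω, Z ω ≤ N * (2 * (k + 1) * C) := by
    simp only [Z]
    rw [Finset.sum_comm]
    refine (Finset.sum_le_sum (g := fun _ => 2 * (N * C)) fun j _ => ?_).trans_eq ?_
    · rw [Finset.sum_add_distrib, two_mul]
      exact add_le_add (hpos _) (hneg _)
    · simp
      ring
  have hlogZ {ω} {t : ℝ} (h : Real.exp (s * t) ≤ Z ω) : t ≤ Real.log (Z ω) / s := by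
    rw [le_div_iff₀ hs, mul_comm]
    exact (Real.le_log_iff_exp_le (hZpos ω)).2 h
  have hsup (ω) : ⨆ x : ℝ, |(c ω x : ℝ) / k - F x| ≤ 1 / k + Real.log (Z ω) / s := by
    refine ciSup_le fun x => ?_
    obtain ⟨j, hj, hc, hu, hl⟩ := hlu x
    have hterm := Finset.single_le_sum (f := fun j =>
      Real.exp (s * ((c ω (u j) : ℝ) / k - F (u j))) +
        Real.exp (-s * ((c ω (l j) : ℝ) / k - F (l j))))
      (fun _ _ => by positivity) (Finset.mem_range.2 (Nat.lt_succ_of_le hj))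
    have hup : (c ω (u j) : ℝ) / k - F (u j) ≤ Real.log (Z ω) / s :=
      hlogZ ((le_add_of_nonneg_right (Real.exp_pos _).le).trans hterm)
    have hlow : -((c ω (l j) : ℝ) / k - F (l j)) ≤ Real.log (Z ω) / s := by
      refine hlogZ ?_
      rw [mul_neg, ← neg_mul]
      exact (le_add_of_nonneg_left (Real.exp_pos _).le).trans hterm
    have hcl : (c ω (l j) : ℝ) / k ≤ c ω x / k := by
      gcongr
      exact (hc ω).1
    have hcu : (c ω x : ℝ) / k ≤ c ω (u j) / k := by
      gcongr
      exact (hc ω).2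
    have hFu := hFstep hu
    have hFl := hFstep hl
    rw [abs_le]
    constructor <;> linarith
  set D : ℝ := 2 * (k + 1) * C with hD
  have hD0 : 0 < D := by positivity
  have hlog (ω) : Real.log (Z ω) ≤ Z ω / D - 1 + Real.log D := by
    have := Real.log_le_sub_one_of_pos (div_pos (hZpos ω) hD0)
    rw [Real.log_div (hZpos ω).ne' hD0.ne'] at this
    linarith
  have hlogsum : ∑ ω, Real.log (Z ω) ≤ N * Real.log D := by
    refine (Finset.sum_le_sum fun ω _ => hlog ω).trans ?_
    have hdiv : (∑ ω, Z ω) / D ≤ N := (div_le_iff₀ hD0).2 hZsum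
    simp only [Finset.sum_add_distrib, Finset.sum_sub_distrib, ← Finset.sum_div, Finset.sum_const,
      Finset.card_univ, nsmul_eq_mul]
    linarith
  rw [div_le_iff₀ hN0]
  calc ∑ ω, ⨆ x : ℝ, |(c ω x : ℝ) / k - F x|
      ≤ ∑ ω, (1 / k + Real.log (Z ω) / s) := Finset.sum_le_sum fun ω _ => hsup ω
    _ = N * (1 / k) + (∑ ω, Real.log (Z ω)) / s := by
        rw [Finset.sum_add_distrib, Finset.sum_const, Finset.card_univ, nsmul_eq_mul,
          Finset.sum_div]
    _ ≤ N * (1 / k) + N * Real.log D / s := by gcongr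
    _ = (1 / k + Real.log D / s) * N := by ring

theorem abs_fESD_swap_mul_sub_le {n k : ℕ} (hk : k ≤ n) (M : Matrix (Fin n) (Fin n) ℂ)
    (hM : M.IsHermitian) (a b : Fin n) (p : Equiv.Perm (Fin n)) (x : ℝ) :
    |fESD hk M hM (Equiv.swap a b * p) x - fESD hk M hM p x| ≤ 2 / k := by
  let S : Finset (Fin k) := univ.filter fun i => p (Fin.castLE hk i) ∈ ({a, b} : Finset (Fin n))
  have hS : S.card ≤ 2 :=
    (Finset.card_le_card_of_injOn (fun i => p (Fin.castLE hk i)) (fun i hi => (mem_filter.1 hi).2)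
      (p.injective.comp (Fin.castLE_injective hk)).injOn).trans Finset.card_le_two
  have hfix (i) (hi : i ∉ S) :
      (Equiv.swap a b * p) (Fin.castLE hk i) = p (Fin.castLE hk i) := by
    simp only [S, mem_filter, mem_univ, true_and, mem_insert, mem_singleton, not_or] at hi
    exact Equiv.swap_apply_of_ne_of_ne hi.1 hi.2
  have hagree : ∀ i ∉ S, ∀ j ∉ S,
      M.submatrix (fun a : Fin k => p (Fin.castLE hk a)) (fun a => p (Fin.castLE hk a)) i j =
        M.submatrix (fun i : Fin k => (Equiv.swap a b * p) (Fin.castLE hk i))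
          (fun i => (Equiv.swap a b * p) (Fin.castLE hk i)) i j := fun i hi j hj => by
    simp only [submatrix_apply, hfix i hi, hfix j hj]
  have hle := card_eigenvalues_le_add_card
    (hM.submatrix fun i : Fin k => p (Fin.castLE hk i))
    (hM.submatrix fun i : Fin k => (Equiv.swap a b * p) (Fin.castLE hk i)) S hagree x
  have hge := card_eigenvalues_le_add_card
    (hM.submatrix fun i : Fin k => (Equiv.swap a b * p) (Fin.castLE hk i))
    (hM.submatrix fun i : Fin k => p (Fin.castLE hk i)) S
    (fun i hi j hj => (hagree i hi j hj).symm) x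
  rw [fESD, fESD, esd, esd, ← sub_div, abs_div, Nat.abs_cast, Fintype.card_fin]
  gcongr
  have hle' := Nat.cast_le (α := ℝ).2 (hle.trans (Nat.add_le_add_left hS _))
  have hge' := Nat.cast_le (α := ℝ).2 (hge.trans (Nat.add_le_add_left hS _))
  rw [Nat.cast_add, Nat.cast_ofNat] at hle' hge'
  rw [abs_le]
  constructor <;> linarith

theorem fESD_congr {n k : ℕ} (hk : k ≤ n) (M : Matrix (Fin n) (Fin n) ℂ)
    (hM : M.IsHermitian) {p q : Equiv.Perm (Fin n)}
    (h : ∀ i : Fin n, (i : ℕ) < k → p i = q i) (x : ℝ) :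
    fESD hk M hM p x = fESD hk M hM q x := by
  have hpq : (fun a : Fin k => p (Fin.castLE hk a)) = fun a => q (Fin.castLE hk a) :=
    funext fun a => h _ a.2
  simp only [fESD]
  congr!

theorem sum_exp_fESD_sub_meanESD_le {n k : ℕ} (hk0 : 0 < k) (hk : k ≤ n)
    (M : Matrix (Fin n) (Fin n) ℂ) (hM : M.IsHermitian) {s : ℝ} (hs : 4 * |s| ≤ k) (x : ℝ) :
    ∑ p, Real.exp (s * (fESD hk M hM p x - meanESD hk M hM x)) ≤
      Fintype.card (Equiv.Perm (Fin n)) * Real.exp (16 * s ^ 2 / k) := by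
  have hk' : (0 : ℝ) < k := Nat.cast_pos.2 hk0
  have hcard : (Fintype.card (Equiv.Perm (Fin n)) : ℝ) ≠ 0 := by
    exact_mod_cast Fintype.card_ne_zero
  have key := Equiv.Perm.sum_exp_sub_mean_le (k := k) (f := fun p => s * fESD hk M hM p x)
    (μ := s * meanESD hk M hM x) (δ := |s| * (2 / k)) ?_ ?_ ?_ ?_
  · convert key using 3
    · rw [mul_sub]
    · rw [mul_pow, mul_pow, sq_abs]
      field_simp
      ring
  · rw [show 2 * (|s| * (2 / k)) = 4 * |s| / k by ring]
    exact (div_le_one hk').2 hs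
  · rw [← Finset.mul_sum, meanESD]
    field_simp
  · intro a b p
    rw [← mul_sub, abs_mul]
    gcongr
    exact abs_fESD_swap_mul_sub_le hk M hM a b p x
  · intro p q hpq
    rw [fESD_congr hk M hM hpq]

theorem abs_fESD_sub_meanESD_le_one {n k : ℕ} (hk : k ≤ n)
    (M : Matrix (Fin n) (Fin n) ℂ) (hM : M.IsHermitian) (p : Equiv.Perm (Fin n)) (x : ℝ) :
    |fESD hk M hM p x - meanESD hk M hM x| ≤ 1 := by
  have hmem (q) : fESD hk M hM q x ∈ Set.Icc (0 : ℝ) 1 := by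
    refine ⟨by unfold fESD esd; positivity, ?_⟩
    unfold fESD esd
    exact div_le_one_of_le₀ (Nat.cast_le.2 (Finset.card_le_univ _)) (Nat.cast_nonneg _)
  have hmean : meanESD hk M hM x ∈ Set.Icc (0 : ℝ) 1 := by
    refine ⟨div_nonneg (Finset.sum_nonneg fun q _ => (hmem q).1) (Nat.cast_nonneg _), ?_⟩
    refine div_le_one_of_le₀ ?_ (Nat.cast_nonneg _)
    simpa using Finset.sum_le_sum fun q (_ : q ∈ univ) => (hmem q).2
  have h := hmem p
  rw [abs_le]
  constructor <;> linarith [h.1, h.2, hmean.1, hmean.2]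

/-- Expected sup-norm deviation of the ESD of a random principal submatrix:
`E ‖F_A - F‖_∞ ≤ (13 + √8 log k) / √k`. -/
theorem esd_sup_expectation {n k : ℕ} (hk0 : 0 < k) (hk : k ≤ n)
    (M : Matrix (Fin n) (Fin n) ℂ) (hM : M.IsHermitian) :
    (∑ p : Equiv.Perm (Fin n), ⨆ x : ℝ, |fESD hk M hM p x - meanESD hk M hM x|) /
        Fintype.card (Equiv.Perm (Fin n)) ≤
      (13 + Real.sqrt 8 * Real.log k) / Real.sqrt k := by
  have hk1 : (1 : ℝ) ≤ k := Nat.one_le_cast.2 hk0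
  have hr1 : 1 ≤ √(k : ℝ) := Real.one_le_sqrt.2 hk1
  have hr0 : 0 < √(k : ℝ) := by linarith
  have hrsq : √(k : ℝ) ^ 2 = k := Real.sq_sqrt (by linarith)
  have hlogk : 0 ≤ Real.log k := Real.log_nonneg hk1
  have hsqrt8 : 2 ≤ √(8 : ℝ) := Real.le_sqrt_of_sq_le (by norm_num)
  have hlog : 2 * Real.log k ≤ √8 * Real.log k := by gcongr
  rcases lt_or_ge k 4 with hk4 | hk4
  · refine le_trans (b := 1) (div_le_one_of_le₀ ?_ (Nat.cast_nonneg _)) ?_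
    · simpa using Finset.sum_le_sum fun p (_ : p ∈ univ) =>
        ciSup_le (abs_fESD_sub_meanESD_le_one hk M hM p)
    · rw [one_le_div hr0]
      have : (k : ℝ) < 4 := by exact_mod_cast hk4
      nlinarith
  have hr2 : 2 ≤ √(k : ℝ) := Real.le_sqrt_of_sq_le (by norm_num; exact_mod_cast hk4)
  let c (p : Equiv.Perm (Fin n)) (x : ℝ) : ℕ := (univ.filter fun i =>
    (hM.submatrix fun a : Fin k => p (Fin.castLE hk a)).eigenvalues i ≤ x).card
  have hc (p x) : fESD hk M hM p x = (c p x : ℝ) / k := by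
    rw [fESD, esd, Fintype.card_fin]
  have habs : |√(k : ℝ) / 2| = √(k : ℝ) / 2 := abs_of_pos (by positivity)
  have hs : 4 * |√(k : ℝ) / 2| ≤ k := by
    rw [habs]
    nlinarith
  have hexp : 16 * (√(k : ℝ) / 2) ^ 2 / k = 4 := by
    rw [div_pow, hrsq]
    field_simp
    norm_num
  have hbound := mean_iSup_abs_sub_le hk0 (c := c) (F := meanESD hk M hM)
    (s := √(k : ℝ) / 2) (C := Real.exp 4)
    (fun p x y hxy => Finset.card_le_card fun i hi => by
      simp only [mem_filter, mem_univ, true_and] at hi ⊢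
      exact hi.trans hxy)
    (fun p x => (Finset.card_le_univ _).trans_eq (Fintype.card_fin k))
    (fun x => by simp only [meanESD, hc]) (by positivity) (Real.exp_pos 4)
    (fun x => by
      simp only [← hc]
      exact hexp ▸ sum_exp_fESD_sub_meanESD_le hk0 hk M hM hs x)
    (fun x => by
      simp only [← hc]
      have := sum_exp_fESD_sub_meanESD_le hk0 hk M hM (s := -(√(k : ℝ) / 2))
        (by rwa [abs_neg]) x
      rwa [neg_sq, hexp] at this)
  simp only [hc]
  refine hbound.trans ?_
  have hlogD : Real.log (2 * (k + 1) * Real.exp 4) ≤ 2 * Real.log 2 + Real.log k + 4 := by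
    calc Real.log (2 * (k + 1) * Real.exp 4) ≤ Real.log (2 ^ 2 * k * Real.exp 4) := by
          refine Real.log_le_log (by positivity) ?_
          gcongr ?_ * _
          linarith
      _ = _ := by
          rw [Real.log_mul (by positivity) (by positivity), Real.log_mul (by positivity)
            (by positivity), Real.log_pow, Real.log_exp]
          norm_num
  have hk_inv : 1 / (k : ℝ) = 1 / √(k : ℝ) / √(k : ℝ) := by
    rw [div_div, ← sq, hrsq]
  have hr_inv : 1 / √(k : ℝ) ≤ 1 := div_le_one_of_le₀ hr1 hr0.le
  rw [hk_inv, show ∀ t, t / (√(k : ℝ) / 2) = 2 * t / √(k : ℝ) from fun t => by field_simp,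
    ← add_div]
  refine div_le_div_of_nonneg_right ?_ hr0.le
  linarith [Real.log_two_lt_d9]
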